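/- For d smaller than the number of monomials in R_{a−1}, one has d_{n,a−1} = d^{<n−1>} − 1. Moreover, a set M of monomials in R_{a−1} is Gotzmann in R_{a−1} if and only if M is Gotzmann in S_{a−1} and x_1^{a−1} ∈ M. -/

import Mathlib

open scoped Classical
open Finset

noncomputable section

/-- The monomials of degree `t` in `n` variables, identified with exponent vectors. -/
def degMon (n t : ℕ) : Finset (Fin n → ℕ) := Finset.Nat.antidiagonalTuple n t

/-- The exponent of `x_1` in a monomial. -/
def x1exp {n : ℕ} (m : Fin n → ℕ) : ℕ := if h : 0 < n then m ⟨0, h⟩ else 0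

/-- `lexLt u v` : `u` is lexicographically smaller than `v` as monomials
(with `x_1 > x_2 > ... > x_n`), i.e. `v > u`. -/
def lexLt {n : ℕ} (u v : Fin n → ℕ) : Prop :=
  ∃ i : Fin n, (∀ j : Fin n, j < i → u j = v j) ∧ u i < v i

/-- `M` is a lexsegment set inside the ground set `G` of monomials. -/
def IsLexSeg {n : ℕ} (G M : Finset (Fin n → ℕ)) : Prop :=
  M ⊆ G ∧ ∀ m ∈ M, ∀ v ∈ G, lexLt m v → v ∈ M

/-- The lexsegment set consisting of the top `d` monomials of `G` in the lex order. -/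
def lexSeg {n : ℕ} (G : Finset (Fin n → ℕ)) (d : ℕ) : Finset (Fin n → ℕ) :=
  G.filter (fun m => (G.filter (fun v => m = v ∨ lexLt m v)).card ≤ d)

/-- `S_1 · M` : all monomials `u * m` with `u` a variable and `m ∈ M`. -/
def S1mul (n : ℕ) (M : Finset (Fin n → ℕ)) : Finset (Fin n → ℕ) :=
  Finset.univ.biUnion (fun i : Fin n => M.image (fun m => m + Pi.single i 1))

/-- `S'_1 · M` : all monomials `x_i * m` with `2 ≤ i ≤ n` and `m ∈ M`. -/
def S1'mul (n : ℕ) (M : Finset (Fin n → ℕ)) : Finset (Fin n → ℕ) :=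
  (Finset.univ.filter (fun i : Fin n => (i : ℕ) ≠ 0)).biUnion
    (fun i => M.image (fun m => m + Pi.single i 1))

/-- `d^{<k>}` : the number of monomials obtained by multiplying each member of the
lexsegment set of `d` monomials of a fixed degree in `k+1` variables by each of the
`k+1` variables.  (We realize it in degree `d`, where the lexsegment set exists;
the number is independent of the chosen degree.  Also `0^{<k>} = 0`.) -/
def growth (d k : ℕ) : ℕ := (S1mul (k + 1) (lexSeg (degMon (k + 1) d) d)).card

/-- The monomials of `R_t` where `R = S/(x_1^a)` : degree-`t` monomials whose
`x_1`-exponent is at most `a - 1`. -/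
def RMon (n a t : ℕ) : Finset (Fin n → ℕ) :=
  (degMon n t).filter (fun m => x1exp m < a)

/-- `R_1 · M` : the monomials of `S_1 · M` not divisible by `x_1^a`. -/
def R1mul (n a : ℕ) (M : Finset (Fin n → ℕ)) : Finset (Fin n → ℕ) :=
  (S1mul n M).filter (fun m => x1exp m < a)

/-- `d_{n,t}` : the size of `R_1 · L` for the lexsegment set `L` of `d` monomials in `R_t`. -/
def dnt (n a t d : ℕ) : ℕ := (R1mul n a (lexSeg (RMon n a t) d)).card

/-- `M^i` : the monomials of `M` divisible by `x_1^i` but not by `x_1^{i+1}`. -/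
def comp {n : ℕ} (M : Finset (Fin n → ℕ)) (i : ℕ) : Finset (Fin n → ℕ) :=
  M.filter (fun m => x1exp m = i)

/-- `I(M)` : the smallest `i` such that `M^i ≠ ∅`. -/
def Imon {n : ℕ} (M : Finset (Fin n → ℕ)) : ℕ := sInf {i | (comp M i).Nonempty}

/-- `M` is Gotzmann in `S_t`. -/
def GotzmannS (n t : ℕ) (M : Finset (Fin n → ℕ)) : Prop :=
  (S1mul n (lexSeg (degMon n t) M.card)).card = (S1mul n M).card

/-- `M` is Gotzmann in `R_t`, `R = S/(x_1^a)`. -/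
def GotzmannR (n a t : ℕ) (M : Finset (Fin n → ℕ)) : Prop :=
  (R1mul n a (lexSeg (RMon n a t) M.card)).card = (R1mul n a M).card

/-- The monomials of degree `t` of `S' = F[x_2,...,x_n]`, viewed inside the `n`
variables as the monomials with `x_1`-exponent `0`. -/
def SpMon (n t : ℕ) : Finset (Fin n → ℕ) :=
  (degMon n t).filter (fun m => x1exp m = 0)

/-- `M` is Gotzmann in `S' = F[x_2,...,x_n]` (in degree `t`). -/
def GotzmannSp (n t : ℕ) (M : Finset (Fin n → ℕ)) : Prop :=
  (S1'mul n (lexSeg (SpMon n t) M.card)).card = (S1'mul n M).card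

/-- Dividing a monomial by the pure power of `x_1` it contains: set the first exponent to `0`. -/
def clearX1 {n : ℕ} (m : Fin n → ℕ) : Fin n → ℕ :=
  fun j => if (j : ℕ) = 0 then 0 else m j

/-- `M^i / x_1` : the monomials `m` of `S'` with `m * x_1^i ∈ M^i` (applied to `M = M^i`). -/
def divX1 {n : ℕ} (M : Finset (Fin n → ℕ)) : Finset (Fin n → ℕ) :=
  M.image clearX1

/-- `u · M` : the monomials `u * m` with `m ∈ M`. -/
def mulMon {n : ℕ} (u : Fin n → ℕ) (M : Finset (Fin n → ℕ)) : Finset (Fin n → ℕ) :=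
  M.image (fun m => u + m)

/-- The set `B` of degree-`t` monomials of `S` divisible by `x_1^a`. -/
def Bset (n a t : ℕ) : Finset (Fin n → ℕ) :=
  (degMon n t).filter (fun m => a ≤ x1exp m)

abbrev ee {n : ℕ} (i : Fin n) : Fin n → ℕ := Pi.single i 1

lemma mem_degMon {n t : ℕ} {m : Fin n → ℕ} : m ∈ degMon n t ↔ ∑ i, m i = t := by
  simp [degMon, Finset.Nat.mem_antidiagonalTuple]

lemma lexLt_irrefl {n : ℕ} (u : Fin n → ℕ) : ¬ lexLt u u := by
  rintro ⟨i, _, h⟩; omega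

lemma lexLt_trans {n : ℕ} {u v w : Fin n → ℕ} (h1 : lexLt u v) (h2 : lexLt v w) : lexLt u w := by
  obtain ⟨i, hi, hi'⟩ := h1
  obtain ⟨j, hj, hj'⟩ := h2
  rcases lt_trichotomy i j with h | h | h
  · exact ⟨i, fun q hq => (hi q hq).trans (hj q (hq.trans h)), by rw [← hj i h]; exact hi'⟩
  · subst h
    exact ⟨i, fun q hq => (hi q hq).trans (hj q hq), hi'.trans hj'⟩
  · exact ⟨j, fun q hq => (hi q (hq.trans h)).trans (hj q hq), by rw [hi j h]; exact hj'⟩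

lemma lexLt_tri {n : ℕ} (u v : Fin n → ℕ) : lexLt u v ∨ u = v ∨ lexLt v u := by
  by_cases h : u = v
  · exact Or.inr (Or.inl h)
  · have hne : (Finset.univ.filter (fun i => u i ≠ v i)).Nonempty := by
      by_contra hc
      rw [Finset.not_nonempty_iff_eq_empty] at hc
      apply h
      funext i
      by_contra hi
      have : i ∈ (Finset.univ.filter (fun i => u i ≠ v i)) := by simp [hi]
      rw [hc] at this
      simp at this
    set p := (Finset.univ.filter (fun i => u i ≠ v i)).min' hne with hp
    have h1 : u p ≠ v p := by
      have := Finset.min'_mem _ hne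
      rw [← hp] at this
      simpa using this
    have h2 : ∀ j, j < p → u j = v j := by
      intro j hj
      by_contra hc
      have : p ≤ j := Finset.min'_le _ _ (by simp [hc])
      exact absurd hj (not_lt.mpr this)
    rcases lt_or_gt_of_ne h1 with h3 | h3
    · exact Or.inl ⟨p, h2, h3⟩
    · exact Or.inr (Or.inr ⟨p, fun j hj => (h2 j hj).symm, h3⟩)

lemma lexLt_asymm {n : ℕ} {u v : Fin n → ℕ} (h : lexLt u v) : ¬ lexLt v u :=
  fun h' => lexLt_irrefl _ (lexLt_trans h h')

/-- a nonempty finite set has a lex-greatest element. -/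
lemma exists_lexMax {n : ℕ} (A : Finset (Fin n → ℕ)) (h : A.Nonempty) :
    ∃ m ∈ A, ∀ v ∈ A, v = m ∨ lexLt v m := by
  induction h using Finset.Nonempty.cons_induction with
  | singleton a => exact ⟨a, by simp, by simp⟩
  | cons a s ha hs ih =>
    obtain ⟨m, hm, hm'⟩ := ih
    rcases lexLt_tri a m with h | h | h
    · refine ⟨m, by simp [hm], fun v hv => ?_⟩
      rcases Finset.mem_cons.mp hv with rfl | hv
      · exact Or.inr h
      · exact hm' v hv
    · subst h; exact absurd hm ha
    · refine ⟨a, by simp, fun v hv => ?_⟩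
      rcases Finset.mem_cons.mp hv with rfl | hv
      · exact Or.inl rfl
      · rcases hm' v hv with rfl | h'
        · exact Or.inr h
        · exact Or.inr (lexLt_trans h' h)

lemma exists_lexMin {n : ℕ} (A : Finset (Fin n → ℕ)) (h : A.Nonempty) :
    ∃ m ∈ A, ∀ v ∈ A, v = m ∨ lexLt m v := by
  induction h using Finset.Nonempty.cons_induction with
  | singleton a => exact ⟨a, by simp, by simp⟩
  | cons a s ha hs ih =>
    obtain ⟨m, hm, hm'⟩ := ih
    rcases lexLt_tri a m with h | h | h
    · refine ⟨a, by simp, fun v hv => ?_⟩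
      rcases Finset.mem_cons.mp hv with rfl | hv
      · exact Or.inl rfl
      · rcases hm' v hv with rfl | h'
        · exact Or.inr h
        · exact Or.inr (lexLt_trans h h')
    · subst h; exact absurd hm ha
    · refine ⟨m, by simp [hm], fun v hv => ?_⟩
      rcases Finset.mem_cons.mp hv with rfl | hv
      · exact Or.inr h
      · exact hm' v hv

lemma IsLexSeg.total {n : ℕ} {G A B : Finset (Fin n → ℕ)} (hA : IsLexSeg G A)
    (hB : IsLexSeg G B) : A ⊆ B ∨ B ⊆ A := by
  by_contra hc
  push Not at hc
  obtain ⟨h1, h2⟩ := hc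
  obtain ⟨x, hx, hx'⟩ := Finset.not_subset.mp h1
  obtain ⟨y, hy, hy'⟩ := Finset.not_subset.mp h2
  rcases lexLt_tri x y with h | h | h
  · exact hy' (hA.2 x hx y (hB.1 hy) h)
  · subst h; exact hx' hy
  · exact hx' (hB.2 y hy x (hA.1 hx) h)

lemma IsLexSeg.eq_of_card {n : ℕ} {G A B : Finset (Fin n → ℕ)} (hA : IsLexSeg G A)
    (hB : IsLexSeg G B) (h : A.card = B.card) : A = B := by
  rcases hA.total hB with h' | h'
  · exact Finset.eq_of_subset_of_card_le h' h.ge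
  · exact (Finset.eq_of_subset_of_card_le h' h.le).symm

/-- adding the next element. -/
lemma IsLexSeg.next {n : ℕ} {G A : Finset (Fin n → ℕ)} (hA : IsLexSeg G A)
    (h : A.card < G.card) : ∃ v ∈ G, v ∉ A ∧ IsLexSeg G (insert v A) := by
  have hne : (G \ A).Nonempty := by
    rw [Finset.sdiff_nonempty]
    intro hs
    exact absurd (Finset.card_le_card hs) (by omega)
  obtain ⟨v, hv, hmax⟩ := exists_lexMax _ hne
  rw [Finset.mem_sdiff] at hv
  refine ⟨v, hv.1, hv.2, Finset.insert_subset hv.1 hA.1, ?_⟩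
  intro m hm w hw hlt
  rw [Finset.mem_insert] at hm ⊢
  by_cases hwA : w ∈ A
  · exact Or.inr hwA
  · rcases hm with rfl | hm
    · rcases hmax w (by simp [hw, hwA]) with h' | h'
      · exact Or.inl h'
      · exact absurd h' (lexLt_asymm hlt)
    · exact Or.inr (hA.2 m hm w hw hlt)

lemma exists_lexSeg {n : ℕ} (G : Finset (Fin n → ℕ)) (d : ℕ) (h : d ≤ G.card) :
    ∃ A, IsLexSeg G A ∧ A.card = d := by
  induction d with
  | zero => exact ⟨∅, ⟨by simp, by simp⟩, by simp⟩
  | succ d ih =>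
    obtain ⟨A, hA, hc⟩ := ih (by omega)
    obtain ⟨v, _, hv, hs⟩ := hA.next (by omega)
    exact ⟨_, hs, by rw [Finset.card_insert_of_notMem hv, hc]⟩

lemma lexSeg_eq {n : ℕ} {G A : Finset (Fin n → ℕ)} (hA : IsLexSeg G A) :
    lexSeg G A.card = A := by
  ext m
  simp only [lexSeg, Finset.mem_filter]
  constructor
  · rintro ⟨hm, hc⟩
    by_contra hmA
    have : insert m A ⊆ G.filter (fun v => m = v ∨ lexLt m v) := by
      intro v hv
      rw [Finset.mem_insert] at hv
      rcases hv with rfl | hv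
      · simp [hm]
      · simp only [Finset.mem_filter]
        refine ⟨hA.1 hv, ?_⟩
        rcases lexLt_tri m v with h | h | h
        · exact Or.inr h
        · exact Or.inl h
        · exact absurd (hA.2 v hv m hm h) hmA
    have := Finset.card_le_card this
    rw [Finset.card_insert_of_notMem hmA] at this
    omega
  · intro hm
    refine ⟨hA.1 hm, Finset.card_le_card ?_⟩
    intro v hv
    simp only [Finset.mem_filter] at hv
    rcases hv with ⟨hv, rfl | h⟩
    · exact hm
    · exact hA.2 m hm v hv h

lemma lexSeg_spec {n : ℕ} (G : Finset (Fin n → ℕ)) (d : ℕ) (h : d ≤ G.card) :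
    IsLexSeg G (lexSeg G d) ∧ (lexSeg G d).card = d := by
  obtain ⟨A, hA, rfl⟩ := exists_lexSeg G d h
  rw [lexSeg_eq hA]
  exact ⟨hA, rfl⟩

lemma mem_S1mul {n : ℕ} {M : Finset (Fin n → ℕ)} {w : Fin n → ℕ} :
    w ∈ S1mul n M ↔ ∃ i, ∃ m ∈ M, m + ee i = w := by
  simp [S1mul]

lemma sum_add_single {n : ℕ} (m : Fin n → ℕ) (i : Fin n) :
    ∑ j, (m + ee i) j = ∑ j, m j + 1 := by
  simp [Finset.sum_add_distrib]

lemma S1mul_subset {n t : ℕ} {M : Finset (Fin n → ℕ)} (h : M ⊆ degMon n t) :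
    S1mul n M ⊆ degMon n (t + 1) := by
  intro w hw
  obtain ⟨i, m, hm, rfl⟩ := mem_S1mul.mp hw
  rw [mem_degMon, sum_add_single, mem_degMon.mp (h hm)]

lemma exists_sub {n : ℕ} (w : Fin n → ℕ) (j : Fin n) (h : 0 < w j) :
    ∃ w', w' + ee j = w := by
  refine ⟨w - ee j, ?_⟩
  funext q
  by_cases hq : q = j
  · subst hq; simp; omega
  · simp [hq]

lemma add_single_ne {n : ℕ} (w : Fin n → ℕ) {j q : Fin n} (h : q ≠ j) :
    (w + ee j) q = w q := by simp [h]

lemma add_single_self {n : ℕ} (w : Fin n → ℕ) (j : Fin n) :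
    (w + ee j) j = w j + 1 := by simp

lemma le_add_single {n : ℕ} (w : Fin n → ℕ) (j q : Fin n) :
    w q ≤ (w + ee j) q := by simp

lemma IsLexSeg.S1mul {n t : ℕ} {L : Finset (Fin n → ℕ)} (hL : IsLexSeg (degMon n t) L) :
    IsLexSeg (degMon n (t + 1)) (S1mul n L) := by
  refine ⟨S1mul_subset hL.1, ?_⟩
  intro x hx w hw hlt
  obtain ⟨i, m, hm, rfl⟩ := mem_S1mul.mp hx
  have hmd := mem_degMon.mp (hL.1 hm)
  have hwd := mem_degMon.mp hw
  obtain ⟨p, hp, hp'⟩ := hlt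
  have hne : (Finset.univ.filter (fun j => 0 < w j)).Nonempty := ⟨p, by simp; omega⟩
  obtain ⟨j, hj, hjmax⟩ : ∃ j, 0 < w j ∧ ∀ q, j < q → w q = 0 := by
    refine ⟨(Finset.univ.filter (fun j => 0 < w j)).max' hne, ?_, ?_⟩
    · have := Finset.max'_mem _ hne
      simpa using this
    · intro q hq
      by_contra hc
      have : q ≤ _ := Finset.le_max' (Finset.univ.filter (fun j => 0 < w j)) q (by simp; omega)
      exact absurd hq (not_lt.mpr this)
  obtain ⟨w', rfl⟩ := exists_sub w j hj
  rw [sum_add_single] at hwd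
  have hw' : w' ∈ degMon n t := mem_degMon.mpr (by omega)
  refine mem_S1mul.mpr ⟨j, w', ?_, rfl⟩
  rcases lexLt_tri m w' with h | h | h
  · exact hL.2 m hm w' hw' h
  · subst h; exact hm
  · exfalso
    obtain ⟨r, hr, hr'⟩ := h
    rcases lt_or_ge r j with hrj | hrj
    · have e1 : (w' + ee j) r = w' r := add_single_ne _ hrj.ne
      have e2 := le_add_single m i r
      have e3 := le_add_single m i p
      rcases lt_trichotomy p r with h | h | h
      · have e4 := add_single_ne w' (h.trans hrj).ne
        have := hr p h
        omega
      · subst h; omega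
      · have := hp r h
        omega
    · have : ∑ q, w' q < ∑ q, m q := by
        apply Finset.sum_lt_sum
        · intro q _
          rcases lt_trichotomy q r with h | h | h
          · exact (hr q h).le
          · subst h; exact hr'.le
          · have := hjmax q (lt_of_le_of_lt hrj h)
            have := le_add_single w' j q
            omega
        · exact ⟨r, Finset.mem_univ _, hr'⟩
      omega

lemma nat_sum_range_le (A : Finset ℕ) :
    ∑ x ∈ Finset.range A.card, x ≤ ∑ x ∈ A, x ∧
    (A ≠ Finset.range A.card → ∑ x ∈ Finset.range A.card, x < ∑ x ∈ A, x) := by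
  have key : A ≠ Finset.range A.card → ∑ x ∈ Finset.range A.card, x < ∑ x ∈ A, x := by
    intro hne
    have h1 : (A \ Finset.range A.card).card = (Finset.range A.card \ A).card :=
      Finset.card_sdiff_comm (by simp)
    have h2 : (A \ Finset.range A.card).Nonempty := by
      rw [Finset.sdiff_nonempty]
      intro hs
      exact hne (Finset.eq_of_subset_of_card_le hs (by simp))
    have h3 : (A \ Finset.range A.card).card * A.card ≤ ∑ x ∈ A \ Finset.range A.card, x := by
      apply Finset.card_nsmul_le_sum
      intro x hx
      simp at hx
      exact hx.2
    have h4 : ∑ x ∈ Finset.range A.card \ A, x < ∑ x ∈ Finset.range A.card \ A, A.card := by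
      apply Finset.sum_lt_sum_of_nonempty
      · rw [← Finset.card_pos, ← h1, Finset.card_pos]; exact h2
      · intro x hx
        simp at hx
        exact hx.1
    rw [Finset.sum_const, smul_eq_mul, ← h1] at h4
    have h5 := Finset.sum_inter_add_sum_sdiff A (Finset.range A.card) (fun x => x)
    have h6 := Finset.sum_inter_add_sum_sdiff (Finset.range A.card) A (fun x => x)
    rw [Finset.inter_comm] at h6
    omega
  refine ⟨?_, key⟩
  by_cases h : A = Finset.range A.card
  · rw [← h]
  · exact (key h).le

section compress
variable {k : ℕ}

/-- forget the exponents of `x_i` and of the last variable. -/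
def rho (i : Fin (k + 1)) (m : Fin (k + 1) → ℕ) : Fin (k + 1) → ℕ :=
  fun j => if j = i ∨ j = Fin.last k then 0 else m j

def fib (i : Fin (k + 1)) (X : Finset (Fin (k + 1) → ℕ)) (r : Fin (k + 1) → ℕ) :
    Finset (Fin (k + 1) → ℕ) := X.filter (fun m => rho i m = r)

def cpr (i : Fin (k + 1)) (t : ℕ) (X : Finset (Fin (k + 1) → ℕ)) : Finset (Fin (k + 1) → ℕ) :=
  (degMon (k + 1) t).filter (fun m => m (Fin.last k) < (fib i X (rho i m)).card)

lemma mem_fib {i : Fin (k + 1)} {X : Finset (Fin (k + 1) → ℕ)} {r m : Fin (k + 1) → ℕ} :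
    m ∈ fib i X r ↔ m ∈ X ∧ rho i m = r := by
  unfold fib; exact Finset.mem_filter

lemma mem_cpr {i : Fin (k + 1)} {t : ℕ} {X : Finset (Fin (k + 1) → ℕ)} {m : Fin (k + 1) → ℕ} :
    m ∈ cpr i t X ↔ m ∈ degMon (k + 1) t ∧ m (Fin.last k) < (fib i X (rho i m)).card := by
  unfold cpr; exact Finset.mem_filter

lemma rho_inj {i : Fin (k + 1)} (hi : i ≠ Fin.last k) {m m' : Fin (k + 1) → ℕ}
    (hs : ∑ j, m j = ∑ j, m' j) (hr : rho i m = rho i m') (hl : m (Fin.last k) = m' (Fin.last k)) :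
    m = m' := by
  have h1 : ∀ j, j ≠ i → m j = m' j := by
    intro j hj
    by_cases hjl : j = Fin.last k
    · subst hjl; exact hl
    · have := congrFun hr j
      simpa [rho, hj, hjl] using this
  have h2 : m i = m' i := by
    rw [← Finset.add_sum_erase _ _ (Finset.mem_univ i),
      ← Finset.add_sum_erase _ m' (Finset.mem_univ i)] at hs
    have : ∑ x ∈ Finset.univ.erase i, m x = ∑ x ∈ Finset.univ.erase i, m' x :=
      Finset.sum_congr rfl (fun x hx => h1 x (Finset.ne_of_mem_erase hx))
    omega
  funext j
  by_cases hj : j = i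
  · subst hj; exact h2
  · exact h1 j hj

lemma rho_add {i : Fin (k + 1)} {m m' : Fin (k + 1) → ℕ} (hr : rho i m = rho i m')
    (q : Fin (k + 1)) : rho i (m + ee q) = rho i (m' + ee q) := by
  funext j
  have := congrFun hr j
  simp only [rho, Pi.add_apply] at this ⊢
  split_ifs with h
  · rfl
  · rw [if_neg h, if_neg h] at this
    rw [this]

lemma rho_add_i {i : Fin (k + 1)} (m : Fin (k + 1) → ℕ) : rho i (m + ee i) = rho i m := by
  funext j
  simp only [rho]
  split_ifs with h
  · rfl
  · rw [add_single_ne]; tauto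

lemma rho_add_last {i : Fin (k + 1)} (m : Fin (k + 1) → ℕ) :
    rho i (m + ee (Fin.last k)) = rho i m := by
  funext j
  simp only [rho]
  split_ifs with h
  · rfl
  · rw [add_single_ne]; tauto

lemma fib_injOn {i : Fin (k + 1)} (hi : i ≠ Fin.last k) {t : ℕ} {X : Finset (Fin (k + 1) → ℕ)}
    (hX : X ⊆ degMon (k + 1) t) (r : Fin (k + 1) → ℕ) :
    Set.InjOn (fun m : Fin (k + 1) → ℕ => m (Fin.last k)) (fib i X r : Set (Fin (k + 1) → ℕ)) := by
  intro m hm m' hm' h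
  simp only [Finset.mem_coe, mem_fib] at hm hm'
  exact rho_inj hi ((mem_degMon.mp (hX hm.1)).trans (mem_degMon.mp (hX hm'.1)).symm)
    (hm.2.trans hm'.2.symm) h

lemma cpr_subset (i : Fin (k + 1)) (t : ℕ) (X : Finset (Fin (k + 1) → ℕ)) :
    cpr i t X ⊆ degMon (k + 1) t := Finset.filter_subset _ _

/-- lowering the last exponent within a fibre -/
lemma exists_lower {i : Fin (k + 1)} (hi : i ≠ Fin.last k) (m : Fin (k + 1) → ℕ) (s : ℕ) :
    ∀ e, m (Fin.last k) = e + s →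
    ∃ m', ∑ j, m' j = ∑ j, m j ∧ rho i m' = rho i m ∧ m' (Fin.last k) = e := by
  induction s generalizing m with
  | zero => exact fun e he => ⟨m, rfl, rfl, by omega⟩
  | succ s ih =>
    intro e he
    obtain ⟨w, rfl⟩ := exists_sub m (Fin.last k) (by omega)
    have h1 := add_single_self w (Fin.last k)
    have h2 := add_single_ne w (Ne.symm hi)
    obtain ⟨m', h3, h4, h5⟩ := ih (w + ee i) e (by omega)
    refine ⟨m', ?_, ?_, h5⟩
    · rw [h3, sum_add_single, sum_add_single]
    · rw [h4, rho_add_i, rho_add_last]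

lemma fib_cpr_image {i : Fin (k + 1)} (hi : i ≠ Fin.last k) {t : ℕ}
    {X : Finset (Fin (k + 1) → ℕ)} (hX : X ⊆ degMon (k + 1) t) (r : Fin (k + 1) → ℕ) :
    (fib i (cpr i t X) r).image (fun m => m (Fin.last k)) = Finset.range (fib i X r).card := by
  ext e
  simp only [Finset.mem_image, Finset.mem_range]
  constructor
  · rintro ⟨m, hm, rfl⟩
    simp only [mem_fib, mem_cpr] at hm ⊢
    obtain ⟨⟨_, h⟩, rfl⟩ := hm
    exact h
  · intro he
    have : ∃ m ∈ fib i X r, e ≤ m (Fin.last k) := by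
      by_contra hc
      push Not at hc
      have h1 : (fib i X r).image (fun m => m (Fin.last k)) ⊆ Finset.range e := by
        intro x hx
        obtain ⟨m, hm, rfl⟩ := Finset.mem_image.mp hx
        exact Finset.mem_range.mpr (hc m hm)
      have h2 := Finset.card_le_card h1
      rw [Finset.card_image_of_injOn (fib_injOn hi hX r), Finset.card_range] at h2
      omega
    obtain ⟨m, hm, hle⟩ := this
    obtain ⟨s, hs⟩ := Nat.exists_eq_add_of_le hle
    obtain ⟨m', h1, h2, h3⟩ := exists_lower hi m s e hs
    simp only [mem_fib] at hm
    have hr : rho i m' = r := h2.trans hm.2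
    refine ⟨m', ?_, h3⟩
    simp only [mem_fib, mem_cpr]
    refine ⟨⟨mem_degMon.mpr (h1.trans (mem_degMon.mp (hX hm.1))), ?_⟩, hr⟩
    rw [hr, h3]
    exact he

lemma fib_cpr_card {i : Fin (k + 1)} (hi : i ≠ Fin.last k) {t : ℕ}
    {X : Finset (Fin (k + 1) → ℕ)} (hX : X ⊆ degMon (k + 1) t) (r : Fin (k + 1) → ℕ) :
    (fib i (cpr i t X) r).card = (fib i X r).card := by
  rw [← Finset.card_image_of_injOn (fib_injOn hi (cpr_subset i t X) r), fib_cpr_image hi hX r,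
    Finset.card_range]

lemma cpr_card {i : Fin (k + 1)} (hi : i ≠ Fin.last k) {t : ℕ}
    {X : Finset (Fin (k + 1) → ℕ)} (hX : X ⊆ degMon (k + 1) t) :
    (cpr i t X).card = X.card := by
  rw [Finset.card_eq_sum_card_fiberwise (f := rho i) (t := (degMon (k + 1) t).image (rho i))
    (s := X), Finset.card_eq_sum_card_fiberwise (f := rho i)
    (t := (degMon (k + 1) t).image (rho i)) (s := cpr i t X)]
  · exact Finset.sum_congr rfl (fun r _ => fib_cpr_card hi hX r)
  · intro x hx
    exact Finset.mem_coe.mpr (Finset.mem_image_of_mem _ (cpr_subset i t X hx))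
  · intro x hx
    exact Finset.mem_coe.mpr (Finset.mem_image_of_mem _ (hX hx))

def pot (X : Finset (Fin (k + 1) → ℕ)) : ℕ := ∑ m ∈ X, m (Fin.last k)

lemma fib_pot {i : Fin (k + 1)} (hi : i ≠ Fin.last k) {t : ℕ}
    {X : Finset (Fin (k + 1) → ℕ)} (hX : X ⊆ degMon (k + 1) t) (r : Fin (k + 1) → ℕ) :
    pot (fib i X r) = ∑ x ∈ (fib i X r).image (fun m => m (Fin.last k)), x := by
  rw [Finset.sum_image (fib_injOn hi hX r)]; rfl

lemma pot_fiber {i : Fin (k + 1)} {t : ℕ}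
    {X : Finset (Fin (k + 1) → ℕ)} (hX : X ⊆ degMon (k + 1) t) :
    pot X = ∑ r ∈ (degMon (k + 1) t).image (rho i), pot (fib i X r) := by
  unfold pot fib
  rw [Finset.sum_fiberwise_of_maps_to]
  intro x hx
  exact Finset.mem_image_of_mem _ (hX hx)

lemma fib_pot_cpr {i : Fin (k + 1)} (hi : i ≠ Fin.last k) {t : ℕ}
    {X : Finset (Fin (k + 1) → ℕ)} (hX : X ⊆ degMon (k + 1) t) (r : Fin (k + 1) → ℕ) :
    pot (fib i (cpr i t X) r) ≤ pot (fib i X r) ∧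
    ((fib i X r).image (fun m => m (Fin.last k)) ≠ Finset.range (fib i X r).card →
      pot (fib i (cpr i t X) r) < pot (fib i X r)) := by
  rw [fib_pot hi hX, fib_pot hi (cpr_subset i t X), fib_cpr_image hi hX]
  have := nat_sum_range_le ((fib i X r).image (fun m => m (Fin.last k)))
  rwa [Finset.card_image_of_injOn (fib_injOn hi hX r)] at this

lemma pot_lt {i : Fin (k + 1)} (hi : i ≠ Fin.last k) {t : ℕ}
    {X : Finset (Fin (k + 1) → ℕ)} (hX : X ⊆ degMon (k + 1) t) (w : Fin (k + 1) → ℕ)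
    (h1 : w + ee (Fin.last k) ∈ X) (h2 : w + ee i ∉ X) : pot (cpr i t X) < pot X := by
  rw [pot_fiber (i := i) hX, pot_fiber (i := i) (cpr_subset i t X)]
  apply Finset.sum_lt_sum
  · exact fun r _ => (fib_pot_cpr hi hX r).1
  · refine ⟨rho i (w + ee (Fin.last k)), Finset.mem_image_of_mem _ (hX h1),
      (fib_pot_cpr hi hX _).2 ?_⟩
    intro heq
    have hm : w (Fin.last k) + 1 ∈
        (fib i X (rho i (w + ee (Fin.last k)))).image (fun m => m (Fin.last k)) :=
      Finset.mem_image.mpr ⟨w + ee (Fin.last k), by simp [fib, h1], by simp⟩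
    rw [heq, Finset.mem_range] at hm
    have hm' : w (Fin.last k) ∈
        (fib i X (rho i (w + ee (Fin.last k)))).image (fun m => m (Fin.last k)) := by
      rw [heq, Finset.mem_range]; omega
    obtain ⟨m, hm, hml⟩ := Finset.mem_image.mp hm'
    simp only [mem_fib] at hm
    apply h2
    have : w + ee i = m := by
      apply rho_inj hi
      · rw [mem_degMon.mp (hX hm.1), ← mem_degMon.mp (hX h1), sum_add_single, sum_add_single]
      · rw [hm.2, rho_add_i, rho_add_last]
      · rw [add_single_ne _ (Ne.symm hi)]; exact hml.symm
    rw [this]; exact hm.1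

lemma S1_cpr {i : Fin (k + 1)} (hi : i ≠ Fin.last k) {t : ℕ} (X : Finset (Fin (k + 1) → ℕ)) :
    S1mul (k + 1) (cpr i t X) ⊆ cpr i (t + 1) (S1mul (k + 1) X) := by
  intro w hw
  have hwd := S1mul_subset (cpr_subset i t X) hw
  obtain ⟨q, m, hm, rfl⟩ := mem_S1mul.mp hw
  simp only [mem_cpr] at hm ⊢
  refine ⟨hwd, ?_⟩
  by_cases hq : q = Fin.last k
  · subst hq
    rw [add_single_self]
    have hne : (fib i X (rho i m)).Nonempty := by
      rw [← Finset.card_pos]; omega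
    obtain ⟨z, hz, hmax⟩ := Finset.exists_max_image _ (fun m => m (Fin.last k)) hne
    have hsub : insert (z + ee (Fin.last k)) ((fib i X (rho i m)).image (fun m => m + ee i)) ⊆
        fib i (S1mul (k + 1) X) (rho i (m + ee (Fin.last k))) := by
      intro y hy
      rw [Finset.mem_insert, Finset.mem_image] at hy
      rcases hy with rfl | ⟨y, hy, rfl⟩
      · simp only [mem_fib] at hz ⊢
        exact ⟨mem_S1mul.mpr ⟨_, z, hz.1, rfl⟩, rho_add hz.2 _⟩
      · simp only [mem_fib] at hy ⊢
        exact ⟨mem_S1mul.mpr ⟨_, y, hy.1, rfl⟩, by rw [rho_add_i, rho_add_last]; exact hy.2⟩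
    have hc := Finset.card_le_card hsub
    rw [Finset.card_insert_of_notMem, Finset.card_image_of_injective _ (add_left_injective _)] at hc
    · omega
    · intro hc
      obtain ⟨y, hy, he⟩ := Finset.mem_image.mp hc
      have h1 := hmax y hy
      have h2 := congrFun he (Fin.last k)
      rw [add_single_self, add_single_ne _ (Ne.symm hi)] at h2
      omega
  · rw [add_single_ne _ (Ne.symm hq)]
    refine lt_of_lt_of_le hm.2 ?_
    rw [← Finset.card_image_of_injective (fib i X (rho i m)) (add_left_injective (ee q))]
    apply Finset.card_le_card
    intro y hy
    obtain ⟨z, hz, rfl⟩ := Finset.mem_image.mp hy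
    simp only [mem_fib] at hz ⊢
    exact ⟨mem_S1mul.mpr ⟨_, z, hz.1, rfl⟩, rho_add hz.2 _⟩

lemma exists_stable {t : ℕ} (N : ℕ) : ∀ (X : Finset (Fin (k + 1) → ℕ)),
    X ⊆ degMon (k + 1) t → pot X = N →
    ∃ Y ⊆ degMon (k + 1) t, Y.card = X.card ∧ (S1mul (k + 1) Y).card ≤ (S1mul (k + 1) X).card ∧
      ∀ w i, w + ee (Fin.last k) ∈ Y → w + ee i ∈ Y := by
  induction N using Nat.strong_induction_on with
  | _ N ih =>
    intro X hX hN
    by_cases h : ∀ w i, w + ee (Fin.last k) ∈ X → w + ee i ∈ X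
    · exact ⟨X, hX, rfl, le_rfl, h⟩
    · push Not at h
      obtain ⟨w, i, h1, h2⟩ := h
      have hi : i ≠ Fin.last k := by rintro rfl; exact h2 h1
      obtain ⟨Y, hY, hc, hs, hst⟩ := ih _ (hN ▸ pot_lt hi hX w h1 h2) (cpr i t X)
        (cpr_subset i t X) rfl
      refine ⟨Y, hY, hc.trans (cpr_card hi hX), hs.trans ?_, hst⟩
      rw [← cpr_card hi (S1mul_subset hX)]
      exact Finset.card_le_card (S1_cpr hi X)

end compress

section slices
variable {k : ℕ}

def sn (w : Fin k → ℕ) (j : ℕ) : Fin (k + 1) → ℕ := Fin.snoc (α := fun _ => ℕ) w j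

@[simp] lemma sn_cast (w : Fin k → ℕ) (j : ℕ) (i : Fin k) : sn w j i.castSucc = w i := by
  simp [sn]

@[simp] lemma sn_last (w : Fin k → ℕ) (j : ℕ) : sn w j (Fin.last k) = j := by
  simp [sn]

lemma sn_surj (m : Fin (k + 1) → ℕ) : ∃ w, m = sn w (m (Fin.last k)) := by
  refine ⟨fun i => m i.castSucc, ?_⟩
  funext i
  refine Fin.lastCases ?_ (fun i => ?_) i <;> simp

lemma sn_inj {w w' : Fin k → ℕ} {j j' : ℕ} (h : sn w j = sn w' j') : w = w' ∧ j = j' := by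
  constructor
  · funext i
    simpa using congrFun h i.castSucc
  · simpa using congrFun h (Fin.last k)

lemma sn_sum (w : Fin k → ℕ) (j : ℕ) : ∑ i, sn w j i = ∑ i, w i + j := by
  rw [Fin.sum_univ_castSucc]; simp

lemma sn_add (w : Fin k → ℕ) (j : ℕ) (i : Fin k) : sn (w + ee i) j = sn w j + ee i.castSucc := by
  funext q
  refine Fin.lastCases ?_ (fun q => ?_) q
  · rw [add_single_ne _ (Fin.castSucc_lt_last i).ne']; simp
  · by_cases h : q = i
    · subst h; simp
    · rw [add_single_ne _ (by simpa using h)]; simp [h]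

lemma sn_add_last (w : Fin k → ℕ) (j : ℕ) : sn w (j + 1) = sn w j + ee (Fin.last k) := by
  funext q
  refine Fin.lastCases ?_ (fun q => ?_) q
  · simp
  · rw [add_single_ne _ (Fin.castSucc_lt_last q).ne]; simp

lemma sn_lex {w w' : Fin k → ℕ} (h : lexLt w w') (j j' : ℕ) : lexLt (sn w j) (sn w' j') := by
  obtain ⟨i, hi, hi'⟩ := h
  refine ⟨i.castSucc, ?_, by simpa using hi'⟩
  intro q hq
  obtain ⟨q, rfl⟩ : ∃ q' : Fin k, q = q'.castSucc :=
    ⟨q.castPred (ne_of_lt (lt_of_lt_of_le hq (Fin.le_last _))), by simp⟩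
  simpa using hi q (by simpa using hq)

def slc (B : Finset (Fin (k + 1) → ℕ)) (j : ℕ) : Finset (Fin k → ℕ) :=
  (B.filter (fun m => m (Fin.last k) = j)).image (fun m i => m i.castSucc)

lemma mem_slc {B : Finset (Fin (k + 1) → ℕ)} {j : ℕ} {w : Fin k → ℕ} :
    w ∈ slc B j ↔ sn w j ∈ B := by
  unfold slc
  rw [Finset.mem_image]
  constructor
  · rintro ⟨m, hm, rfl⟩
    rw [Finset.mem_filter] at hm
    obtain ⟨w, hw⟩ := sn_surj m
    rw [hm.2] at hw
    subst hw
    simpa using hm.1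
  · intro h
    exact ⟨sn w j, by simp [h], by simp⟩

lemma slc_card (B : Finset (Fin (k + 1) → ℕ)) (j : ℕ) :
    (slc B j).card = (B.filter (fun m => m (Fin.last k) = j)).card := by
  have : B.filter (fun m => m (Fin.last k) = j) = (slc B j).image (fun w => sn w j) := by
    ext m
    rw [Finset.mem_filter, Finset.mem_image]
    constructor
    · rintro ⟨hm, rfl⟩
      obtain ⟨w, hw⟩ := sn_surj m
      exact ⟨w, mem_slc.mpr (hw ▸ hm), hw.symm⟩
    · rintro ⟨w, hw, rfl⟩
      exact ⟨mem_slc.mp hw, by simp⟩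
  rw [this, Finset.card_image_of_injective]
  exact fun w w' h => (sn_inj h).1

lemma le_of_mem_degMon {n t : ℕ} {m : Fin n → ℕ} (h : m ∈ degMon n t) (i : Fin n) : m i ≤ t := by
  rw [← mem_degMon.mp h]
  exact Finset.single_le_sum (f := m) (fun _ _ => Nat.zero_le _) (Finset.mem_univ i)

lemma card_slices {t : ℕ} {B : Finset (Fin (k + 1) → ℕ)} (hB : B ⊆ degMon (k + 1) t) :
    B.card = ∑ j ∈ Finset.range (t + 1), (slc B j).card := by
  rw [Finset.card_eq_sum_card_fiberwise (f := fun m => m (Fin.last k)) (t := Finset.range (t + 1))]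
  · exact Finset.sum_congr rfl (fun j _ => (slc_card B j).symm)
  · intro m hm
    have := le_of_mem_degMon (hB hm) (Fin.last k)
    simp; omega

lemma slc_subset {t j : ℕ} {B : Finset (Fin (k + 1) → ℕ)} (hB : B ⊆ degMon (k + 1) (t + j)) :
    slc B j ⊆ degMon k t := by
  intro w hw
  have := mem_degMon.mp (hB (mem_slc.mp hw))
  rw [sn_sum] at this
  rw [mem_degMon]; omega

lemma IsLexSeg.slc {t j : ℕ} {L : Finset (Fin (k + 1) → ℕ)}
    (hL : IsLexSeg (degMon (k + 1) (t + j)) L) : IsLexSeg (degMon k t) (slc L j) := by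
  refine ⟨slc_subset hL.1, ?_⟩
  intro m hm v hv hlt
  rw [mem_slc] at hm ⊢
  exact hL.2 _ hm _ (mem_degMon.mpr (by rw [sn_sum, mem_degMon.mp hv])) (sn_lex hlt _ _)

/-- lower bound for the growth, by `x_n M` and the last-variable-free part. -/
lemma S1_lower (M : Finset (Fin (k + 1) → ℕ)) :
    M.card + (S1mul k (slc M 0)).card ≤ (S1mul (k + 1) M).card := by
  have h1 : (M.image (fun m => m + ee (Fin.last k))).card = M.card :=
    Finset.card_image_of_injective _ (add_left_injective _)
  have h2 : ((S1mul k (slc M 0)).image (fun w => sn w 0)).card = (S1mul k (slc M 0)).card :=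
    Finset.card_image_of_injective _ (fun w w' h => (sn_inj h).1)
  rw [← h1, ← h2, ← Finset.card_union_of_disjoint]
  · apply Finset.card_le_card
    intro x hx
    rw [Finset.mem_union, Finset.mem_image, Finset.mem_image] at hx
    rcases hx with ⟨m, hm, rfl⟩ | ⟨w, hw, rfl⟩
    · exact mem_S1mul.mpr ⟨_, m, hm, rfl⟩
    · obtain ⟨i, z, hz, rfl⟩ := mem_S1mul.mp hw
      exact mem_S1mul.mpr ⟨i.castSucc, _, mem_slc.mp hz, (sn_add _ _ _).symm⟩
  · rw [Finset.disjoint_left]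
    intro x hx hx'
    obtain ⟨m, hm, rfl⟩ := Finset.mem_image.mp hx
    obtain ⟨w, hw, h⟩ := Finset.mem_image.mp hx'
    have := congrFun h (Fin.last k)
    rw [add_single_self, sn_last] at this
    omega

lemma S1_upper {t : ℕ} {L : Finset (Fin (k + 1) → ℕ)} (hL : IsLexSeg (degMon (k + 1) t) L) :
    (S1mul (k + 1) L).card ≤ L.card + (S1mul k (slc L 0)).card := by
  have h1 : (L.image (fun m => m + ee (Fin.last k))).card = L.card :=
    Finset.card_image_of_injective _ (add_left_injective _)
  have h2 : ((S1mul k (slc L 0)).image (fun w => sn w 0)).card = (S1mul k (slc L 0)).card :=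
    Finset.card_image_of_injective _ (fun w w' h => (sn_inj h).1)
  rw [← h1, ← h2]
  refine le_trans (Finset.card_le_card ?_) (Finset.card_union_le _ _)
  intro x hx
  rw [Finset.mem_union, Finset.mem_image, Finset.mem_image]
  obtain ⟨q, m, hm, rfl⟩ := mem_S1mul.mp hx
  by_cases hq : q = Fin.last k
  · subst hq; exact Or.inl ⟨m, hm, rfl⟩
  · obtain ⟨i, rfl⟩ : ∃ i : Fin k, q = i.castSucc := ⟨q.castPred hq, by simp⟩
    by_cases h0 : m (Fin.last k) = 0
    · right
      obtain ⟨w, hw⟩ := sn_surj m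
      rw [h0] at hw
      subst hw
      exact ⟨w + ee i, mem_S1mul.mpr ⟨i, w, mem_slc.mpr hm, rfl⟩, sn_add _ _ _⟩
    · left
      obtain ⟨w, rfl⟩ := exists_sub m (Fin.last k) (by omega)
      refine ⟨w + ee i.castSucc, ?_, by abel⟩
      refine hL.2 _ hm _ ?_ ⟨i.castSucc, ?_, ?_⟩
      · have := mem_degMon.mp (hL.1 hm)
        rw [mem_degMon, sum_add_single]
        rwa [sum_add_single] at this
      · intro j hj
        rw [add_single_ne _ hj.ne, add_single_ne _ (hj.trans (Fin.castSucc_lt_last i)).ne]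
      · rw [add_single_self, add_single_ne _ (Fin.castSucc_lt_last i).ne]
        omega

end slices

def Mac (k : ℕ) : Prop := ∀ (t : ℕ) (M L : Finset (Fin k → ℕ)), M ⊆ degMon k t →
  IsLexSeg (degMon k t) L → L.card ≤ M.card → (S1mul k L).card ≤ (S1mul k M).card

lemma green {k : ℕ} (ih : Mac (k + 1)) {t : ℕ} {M L : Finset (Fin (k + 1 + 1) → ℕ)}
    (hM : M ⊆ degMon (k + 1 + 1) t) (hL : IsLexSeg (degMon (k + 1 + 1) t) L)
    (hc : L.card ≤ M.card)
    (hst : ∀ w i, w + ee (Fin.last (k + 1)) ∈ M → w + ee i ∈ M) :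
    (slc L 0).card ≤ (slc M 0).card := by
  by_contra hlt
  push Not at hlt
  have hne : (slc L 0).Nonempty := by rw [← Finset.card_pos]; omega
  obtain ⟨u, hu, hmin⟩ := exists_lexMin _ hne
  have huL := mem_slc.mp hu
  set L' := (degMon (k + 1 + 1) t).filter (fun w => lexLt (sn u 0) w) with hL'def
  have memL' : ∀ w, w ∈ L' ↔ w ∈ degMon (k + 1 + 1) t ∧ lexLt (sn u 0) w := by
    intro w; rw [hL'def, Finset.mem_filter]
  have hL' : IsLexSeg (degMon (k + 1 + 1) t) L' := by
    refine ⟨Finset.filter_subset _ _, ?_⟩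
    intro m hm v hv h
    rw [memL'] at hm ⊢
    exact ⟨hv, lexLt_trans hm.2 h⟩
  have hu' : sn u 0 ∉ L' := fun h => lexLt_irrefl _ ((memL' _).mp h).2
  have hcard : L'.card < L.card := by
    have : insert (sn u 0) L' ⊆ L := by
      intro x hx
      rcases Finset.mem_insert.mp hx with rfl | hx
      · exact huL
      · rw [memL'] at hx
        exact hL.2 _ huL _ hx.1 hx.2
    have := Finset.card_le_card this
    rw [Finset.card_insert_of_notMem hu'] at this
    omega
  have key : ∀ j, j ≤ t → (slc M j).card ≤ (slc L' j).card := by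
    intro j
    induction j with
    | zero =>
      intro _
      have : slc L 0 ⊆ insert u (slc L' 0) := by
        intro w hw
        rw [Finset.mem_insert]
        rcases hmin w hw with h | h
        · exact Or.inl h
        · right
          rw [mem_slc, memL']
          exact ⟨hL.1 (mem_slc.mp hw), sn_lex h _ _⟩
      have h1 := Finset.card_le_card this
      have h2 := Finset.card_insert_le u (slc L' 0)
      omega
    | succ j ihj =>
      intro hj
      have ihj := ihj (by omega)
      obtain ⟨s, rfl⟩ : ∃ s, t = s + (j + 1) := ⟨t - (j + 1), by omega⟩
      by_contra hcon
      push Not at hcon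
      have hMs : slc M (j + 1) ⊆ degMon (k + 1) s := slc_subset hM
      have hLs : IsLexSeg (degMon (k + 1) s) (slc L' (j + 1)) := hL'.slc
      have hLj : IsLexSeg (degMon (k + 1) (s + 1)) (slc L' j) :=
        IsLexSeg.slc (by rwa [show s + 1 + j = s + (j + 1) by ring])
      obtain ⟨v, hv, hvn, hseg⟩ := hLs.next (lt_of_lt_of_le hcon (Finset.card_le_card hMs))
      have h1 := ih s _ _ hMs hseg (by rw [Finset.card_insert_of_notMem hvn]; omega)
      have h2 : S1mul (k + 1) (slc M (j + 1)) ⊆ slc M j := by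
        intro x hx
        obtain ⟨i, w, hw, rfl⟩ := mem_S1mul.mp hx
        rw [mem_slc] at hw ⊢
        rw [sn_add_last] at hw
        rw [sn_add]
        exact hst _ _ hw
      have h3 := Finset.card_le_card h2
      have h4 : v + ee (Fin.last k) ∈ S1mul (k + 1) (insert v (slc L' (j + 1))) :=
        mem_S1mul.mpr ⟨_, v, Finset.mem_insert_self _ _, rfl⟩
      have h5 : v + ee (Fin.last k) ∉ slc L' j := by
        intro hmem
        rw [mem_slc, memL'] at hmem
        obtain ⟨_, hlex⟩ := hmem
        have hdeg : sn v (j + 1) ∈ degMon (k + 1 + 1) (s + (j + 1)) := by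
          rw [mem_degMon, sn_sum, mem_degMon.mp hv]
        rcases lexLt_tri (sn u 0) (sn v (j + 1)) with h | h | h
        · exact hvn (mem_slc.mpr ((memL' _).mpr ⟨hdeg, h⟩))
        · have := (sn_inj h).2
          omega
        · obtain ⟨p, hp, hp'⟩ := h
          have hud := mem_degMon.mp (hL.1 huL)
          have hvd := mem_degMon.mp hv
          rw [sn_sum] at hud
          revert hp hp'
          refine Fin.lastCases ?_ (fun p => ?_) p
          · intro _ h; simp at h
          · intro hp hp'
            rw [sn_cast, sn_cast] at hp'
            have hpq : ∀ q, q < p → v q = u q := by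
              intro q hq
              have := hp q.castSucc (by simpa using hq)
              simpa using this
            obtain ⟨r, hr, hr'⟩ := hlex
            revert hr hr'
            refine Fin.lastCases ?_ (fun r => ?_) r
            · intro hr hr'
              have : ∀ q, u q = (v + ee (Fin.last k)) q := by
                intro q
                have := hr q.castSucc (Fin.castSucc_lt_last q)
                simpa only [sn_cast] using this
              have hsum : ∑ q, u q = ∑ q, (v + ee (Fin.last k)) q :=
                Finset.sum_congr rfl (fun q _ => this q)
              rw [sum_add_single] at hsum
              rw [sn_last, sn_last] at hr'
              omega
            · intro hr hr'
              rw [sn_cast, sn_cast] at hr'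
              have hrq : ∀ q, q < r → u q = (v + ee (Fin.last k)) q := by
                intro q hq
                have := hr q.castSucc (by simpa using hq)
                simpa only [sn_cast] using this
              have hple : p ≤ Fin.last k := Fin.le_last p
              have hrle : r ≤ Fin.last k := Fin.le_last r
              rcases lt_trichotomy r p with h | h | h
              · rw [add_single_ne _ (lt_of_lt_of_le h hple).ne, hpq r h] at hr'
                omega
              · subst h
                by_cases hrl : r = Fin.last k
                · rw [hrl, add_single_self] at hr'
                  rw [hrl] at hp'
                  omega
                · rw [add_single_ne _ hrl] at hr'
                  omega
              · have := hrq p h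
                rw [add_single_ne _ (lt_of_lt_of_le h hrle).ne] at this
                omega
      have h6 : slc L' j ⊆ S1mul (k + 1) (insert v (slc L' (j + 1))) := by
        rcases hLj.total hseg.S1mul with h | h
        · exact h
        · exact absurd (h h4) h5
      have h7 : (slc L' j).card < (S1mul (k + 1) (insert v (slc L' (j + 1)))).card :=
        Finset.card_lt_card (Finset.ssubset_iff_subset_ne.mpr ⟨h6, fun h => h5 (h ▸ h4)⟩)
      omega
  have hfin : M.card ≤ L'.card := by
    rw [card_slices hM, card_slices hL'.1]
    exact Finset.sum_le_sum (fun j hj => key j (by rw [Finset.mem_range] at hj; omega))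
  omega

lemma mac_step {k : ℕ} (ih : Mac (k + 1)) : Mac (k + 1 + 1) := by
  intro t M L hM hL hc
  obtain ⟨Y, hY, hcY, hsY, hst⟩ := exists_stable (t := t) _ M hM rfl
  refine le_trans ?_ hsY
  have hg := green ih hY hL (by omega) hst
  have h1 := S1_upper hL
  have h2 := S1_lower Y
  have h3 := ih t _ _ (slc_subset (t := t) (j := 0) hY) (IsLexSeg.slc (t := t) (j := 0) hL) hg
  omega

lemma mac_one : Mac 1 := by
  intro t M L hM hL hc
  have huniq : ∀ x ∈ degMon 1 t, ∀ y ∈ degMon 1 t, x = y := by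
    intro x hx y hy
    have h1 := mem_degMon.mp hx
    have h2 := mem_degMon.mp hy
    funext i
    rw [Fin.sum_univ_one] at h1 h2
    rw [Subsingleton.elim i 0]; omega
  rcases L.eq_empty_or_nonempty with rfl | ⟨x, hx⟩
  · simp [S1mul]
  · have hMn : M.Nonempty := by
      rw [← Finset.card_pos]
      have := Finset.card_pos.mpr ⟨x, hx⟩
      omega
    obtain ⟨y, hy⟩ := hMn
    have : L ⊆ M := by
      intro z hz
      rw [huniq z (hL.1 hz) y (hM hy)]; exact hy
    apply Finset.card_le_card
    intro z hz
    obtain ⟨i, m, hm, rfl⟩ := mem_S1mul.mp hz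
    exact mem_S1mul.mpr ⟨i, m, this hm, rfl⟩

lemma macaulay (k : ℕ) : Mac (k + 1) := by
  induction k with
  | zero => exact mac_one
  | succ k ih => exact mac_step ih

lemma RMon_eq (n a : ℕ) (ha : 1 ≤ a) : RMon n a (a - 1) = degMon n (a - 1) := by
  unfold RMon
  rw [Finset.filter_eq_self]
  intro m hm
  unfold x1exp
  split_ifs with h
  · have := le_of_mem_degMon hm ⟨0, h⟩
    omega
  · omega

lemma x1exp_succ {k : ℕ} (m : Fin (k + 1) → ℕ) : x1exp m = m 0 := by
  simp [x1exp]

/-- the monomial `x_1^t`. -/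
def PP (n t : ℕ) : Fin n → ℕ := fun j : Fin n => if (j : ℕ) = 0 then t else 0

lemma PP_zero {k t : ℕ} : PP (k + 1) t 0 = t := by simp [PP]

lemma PP_succ {k t : ℕ} (i : Fin k) : PP (k + 1) t i.succ = 0 := by simp [PP]

lemma PP_mem (k t : ℕ) : PP (k + 1) t ∈ degMon (k + 1) t := by
  rw [mem_degMon, Fin.sum_univ_succ, PP_zero]
  simp [PP_succ]

lemma PP_add (k t : ℕ) : PP (k + 1) t + ee 0 = PP (k + 1) (t + 1) := by
  funext j
  refine Fin.cases ?_ (fun j => ?_) j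
  · rw [add_single_self, PP_zero, PP_zero]
  · rw [add_single_ne _ (Fin.succ_ne_zero j), PP_succ, PP_succ]

lemma eq_PP {k t : ℕ} {m : Fin (k + 1) → ℕ} (hm : m ∈ degMon (k + 1) t) (h : t ≤ m 0) :
    m = PP (k + 1) t := by
  have hs := mem_degMon.mp hm
  rw [Fin.sum_univ_succ] at hs
  have h0 : ∑ i : Fin k, m i.succ = 0 := by omega
  rw [Finset.sum_eq_zero_iff] at h0
  funext j
  refine Fin.cases ?_ (fun j => ?_) j
  · rw [PP_zero]; omega
  · rw [PP_succ]; exact h0 j (Finset.mem_univ _)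

lemma R1_card {k t : ℕ} {M : Finset (Fin (k + 1) → ℕ)} (hM : M ⊆ degMon (k + 1) t) :
    (R1mul (k + 1) (t + 1) M).card + (if PP (k + 1) t ∈ M then 1 else 0) =
      (S1mul (k + 1) M).card := by
  unfold R1mul
  rw [← Finset.card_filter_add_card_filter_not (s := S1mul (k + 1) M)
    (fun m => x1exp m < t + 1)]
  congr 1
  have hmem : ∀ w, w ∈ (S1mul (k + 1) M).filter (fun m => ¬ x1exp m < t + 1) →
      PP (k + 1) t ∈ M ∧ w = PP (k + 1) (t + 1) := by
    intro w hw
    rw [Finset.mem_filter, x1exp_succ] at hw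
    have hwP := eq_PP (S1mul_subset hM hw.1) (by omega)
    refine ⟨?_, hwP⟩
    obtain ⟨i, m, hm, hmw⟩ := mem_S1mul.mp hw.1
    have h0 : t ≤ m 0 := by
      have h1 := hw.2
      rw [← hmw] at h1
      by_cases hi : (0 : Fin (k + 1)) = i
      · subst hi; rw [add_single_self] at h1; omega
      · rw [add_single_ne _ hi] at h1; omega
    rw [← eq_PP (hM hm) h0]; exact hm
  split_ifs with hP
  · symm
    rw [Finset.card_eq_one]
    refine ⟨PP (k + 1) (t + 1), ?_⟩
    ext w
    rw [Finset.mem_singleton]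
    refine ⟨fun hw => (hmem w hw).2, ?_⟩
    rintro rfl
    rw [Finset.mem_filter, x1exp_succ, PP_zero]
    exact ⟨mem_S1mul.mpr ⟨0, _, hP, PP_add k t⟩, by omega⟩
  · symm
    rw [Finset.card_eq_zero, Finset.eq_empty_iff_forall_notMem]
    exact fun w hw => hP (hmem w hw).1

lemma PP_mem_lex {k t : ℕ} {L : Finset (Fin (k + 1) → ℕ)} (hL : IsLexSeg (degMon (k + 1) t) L)
    (hne : L.Nonempty) : PP (k + 1) t ∈ L := by
  obtain ⟨m, hm⟩ := hne
  by_cases h : t ≤ m 0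
  · rw [← eq_PP (hL.1 hm) h]; exact hm
  · refine hL.2 m hm _ (PP_mem k t) ⟨0, ?_, ?_⟩
    · intro j hj
      exact absurd hj (Fin.not_lt_zero j)
    · rw [PP_zero]; omega

lemma lexSeg_shift {k t : ℕ} {L : Finset (Fin (k + 1) → ℕ)} (hL : IsLexSeg (degMon (k + 1) t) L) :
    IsLexSeg (degMon (k + 1) (t + 1)) (L.image (fun m => m + ee 0)) := by
  refine ⟨?_, ?_⟩
  · intro x hx
    obtain ⟨m, hm, rfl⟩ := Finset.mem_image.mp hx
    rw [mem_degMon, sum_add_single, mem_degMon.mp (hL.1 hm)]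
  · intro x hx v hv hlt
    obtain ⟨m, hm, rfl⟩ := Finset.mem_image.mp hx
    obtain ⟨i, hi, hi'⟩ := hlt
    have h0 : 0 < v 0 := by
      have e := add_single_self m 0
      by_cases h : i = 0
      · subst h; omega
      · have := hi 0 (Fin.pos_of_ne_zero h)
        omega
    obtain ⟨w, rfl⟩ := exists_sub v 0 h0
    have hw := mem_degMon.mp hv
    rw [sum_add_single] at hw
    refine Finset.mem_image.mpr ⟨w, hL.2 m hm w (mem_degMon.mpr (by omega)) ⟨i, ?_, ?_⟩, rfl⟩
    · intro j hj
      have := hi j hj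
      simpa using this
    · simpa using hi'

lemma S1_shift {k : ℕ} (L : Finset (Fin (k + 1) → ℕ)) :
    (S1mul (k + 1) (L.image (fun m => m + ee 0))).card = (S1mul (k + 1) L).card := by
  rw [← Finset.card_image_of_injective (S1mul (k + 1) L) (add_left_injective (ee 0))]
  congr 1
  ext w
  rw [mem_S1mul, Finset.mem_image]
  constructor
  · rintro ⟨i, m, hm, rfl⟩
    obtain ⟨z, hz, rfl⟩ := Finset.mem_image.mp hm
    exact ⟨z + ee i, mem_S1mul.mpr ⟨i, z, hz, rfl⟩, by abel⟩
  · rintro ⟨m, hm, rfl⟩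
    obtain ⟨i, z, hz, rfl⟩ := mem_S1mul.mp hm
    exact ⟨i, z + ee 0, Finset.mem_image.mpr ⟨z, hz, rfl⟩, by abel⟩

lemma lex_indep {k t : ℕ} (d s : ℕ) (h : d ≤ (degMon (k + 1) t).card) :
    d ≤ (degMon (k + 1) (t + s)).card ∧
    (S1mul (k + 1) (lexSeg (degMon (k + 1) (t + s)) d)).card =
      (S1mul (k + 1) (lexSeg (degMon (k + 1) t) d)).card := by
  induction s with
  | zero => exact ⟨h, rfl⟩
  | succ s ih =>
    obtain ⟨h1, h2⟩ := ih
    obtain ⟨hL, hc⟩ := lexSeg_spec _ _ h1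
    have hS := lexSeg_shift hL
    have hcard := Finset.card_image_of_injective (lexSeg (degMon (k + 1) (t + s)) d)
      (add_left_injective (ee (0 : Fin (k + 1))))
    rw [hc] at hcard
    have heq := lexSeg_eq hS
    rw [hcard] at heq
    refine ⟨?_, ?_⟩
    · have := Finset.card_le_card hS.1
      rw [hcard] at this
      exact this
    · rw [← h2, ← S1_shift (lexSeg (degMon (k + 1) (t + s)) d), ← heq]
      rfl

lemma le_card_degMon (k d : ℕ) : d ≤ (degMon (k + 1 + 1) d).card := by
  have : ((Finset.range d).image (fun j => sn (PP (k + 1) (d - j)) j)) ⊆ degMon (k + 1 + 1) d := by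
    intro x hx
    obtain ⟨j, hj, rfl⟩ := Finset.mem_image.mp hx
    rw [Finset.mem_range] at hj
    rw [mem_degMon, sn_sum, mem_degMon.mp (PP_mem k (d - j))]
    omega
  have h := Finset.card_le_card this
  rw [Finset.card_image_of_injective _ (fun j j' h => (sn_inj h).2), Finset.card_range] at h
  exact h

lemma degMon_one_card (t : ℕ) : (degMon 1 t).card ≤ 1 := by
  rw [Finset.card_le_one]
  intro x hx y hy
  have h1 := mem_degMon.mp hx
  have h2 := mem_degMon.mp hy
  funext i
  rw [Fin.sum_univ_one] at h1 h2
  rw [Subsingleton.elim i 0]; omega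

/-- `d_{n,a-1} = d^{<n-1>} - 1`; moreover, a (nonempty) set `M` of
monomials in `R_{a-1}` is Gotzmann in `R_{a-1}` if and only if `M` is Gotzmann in
`S_{a-1}` and `x_1^{a-1} ∈ M`. -/
theorem stmt_6 (n a : ℕ) (ha : 1 ≤ a) :
    (∀ d : ℕ, 0 < d → d < (RMon n a (a - 1)).card →
      dnt n a (a - 1) d = growth d (n - 1) - 1) ∧
    (∀ M : Finset (Fin n → ℕ), M.Nonempty → M ⊆ RMon n a (a - 1) →
      (GotzmannR n a (a - 1) M ↔
        GotzmannS n (a - 1) M ∧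
          (fun j : Fin n => if (j : ℕ) = 0 then a - 1 else 0) ∈ M)) := by
  rw [RMon_eq n a ha]
  obtain ⟨t, rfl⟩ : ∃ t, a = t + 1 := ⟨a - 1, by omega⟩
  rw [Nat.add_sub_cancel]
  have hR := RMon_eq n (t + 1) ha
  rw [Nat.add_sub_cancel] at hR
  unfold dnt GotzmannR GotzmannS
  rw [hR]
  change _ ∧ ∀ M : Finset (Fin n → ℕ), M.Nonempty → M ⊆ degMon n t → (_ ↔ _ ∧ PP n t ∈ M)
  rcases n with _ | k
  · constructor
    · intro d hd hlt
      have : (degMon 0 t).card ≤ 1 :=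
        Finset.card_le_one.mpr (fun x _ y _ => Subsingleton.elim x y)
      omega
    · intro M hne hM
      obtain ⟨m, hm⟩ := hne
      have h1 : PP 0 t ∈ M := by rw [Subsingleton.elim (PP 0 t) m]; exact hm
      simp [R1mul, S1mul, h1]
  · have hlexR : ∀ d, 0 < d → d ≤ (degMon (k + 1) t).card →
        (R1mul (k + 1) (t + 1) (lexSeg (degMon (k + 1) t) d)).card + 1 =
          (S1mul (k + 1) (lexSeg (degMon (k + 1) t) d)).card := by
      intro d hd hle
      obtain ⟨hL, hc⟩ := lexSeg_spec _ _ hle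
      have := R1_card hL.1
      rwa [if_pos (PP_mem_lex hL (by rw [← Finset.card_pos]; omega))] at this
    constructor
    · intro d hd hlt
      have h1 := hlexR d hd hlt.le
      rcases k with _ | k
      · have := degMon_one_card t
        have : d < (degMon 1 t).card := hlt
        omega
      · have h2 := (lex_indep d d hlt.le).2
        have h3 := (lex_indep d t (le_card_degMon k d)).2
        rw [Nat.add_comm d t] at h3
        have h4 : growth d (k + 1 + 1 - 1) =
            (S1mul (k + 1 + 1) (lexSeg (degMon (k + 1 + 1) d) d)).card := rfl
        omega
    · intro M hne hM
      have hpos := Finset.card_pos.mpr hne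
      have hle := Finset.card_le_card hM
      have h1 := hlexR M.card hpos hle
      have h2 := R1_card hM
      obtain ⟨hL, hc⟩ := lexSeg_spec _ _ hle
      have h3 := macaulay k t M _ hM hL hc.le
      by_cases hP : PP (k + 1) t ∈ M
      · rw [if_pos hP] at h2
        simp only [hP, and_true]
        omega
      · rw [if_neg hP] at h2
        simp only [hP, and_false, iff_false]
        omega
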